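/- Fix weights W_K ∈ ℝ^{d_in×d_K}, W_V ∈ ℝ^{d_in×d_V} with d_K even and a feature map φ: ℝ^{d_K} → ℝ^{d_K}. Let X' ∈ ℝ^{M×d_in}, X ∈ ℝ^{N×d_in}, and let K''_j = ([X';X])_j W_K and V''_j = ([X';X])_j W_V denote the Keys and Values of the concatenated input, with K_j = X_j W_K, V_j = X_j W_V, K'_j = X'_j W_K, V'_j = X'_j W_V. Then for every i ∈ {1,…,N}, the rotary-encoded Key-Value matrix of the concatenated input up to position M+i decomposes as Σ_{j=1}^{M+i} R_{Θ,j} φ(K''_j) V''^T_j = R_{Θ,M} ( Σ_{j=1}^{i} R_{Θ,j} φ(K_j) V_j^T + Σ_{j=1}^{M} R_{Θ,j−M} φ(K'_j) V'^T_j ). -/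

import Mathlib

open Matrix

/-- The rotary (RoPE) matrix `R_{Θ,m} ∈ ℝ^{d×d}` for even `d = 2*h`, angles
`θ : Fin h → ℝ` and shift `m : ℤ`: block-diagonal with `t`-th 2×2 block
`[[cos(mθ_t), −sin(mθ_t)], [sin(mθ_t), cos(mθ_t)]]`. -/
noncomputable def rotary (h : ℕ) (θ : Fin h → ℝ) (m : ℤ) :
    Matrix (Fin (2 * h)) (Fin (2 * h)) ℝ :=
  Matrix.of fun i j =>
    if i.val / 2 = j.val / 2 then
      if i.val % 2 = 0 then
        if j.val % 2 = 0 then Real.cos ((m : ℝ) * θ ⟨i.val / 2, by have := i.isLt; omega⟩)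
        else -Real.sin ((m : ℝ) * θ ⟨i.val / 2, by have := i.isLt; omega⟩)
      else
        if j.val % 2 = 0 then Real.sin ((m : ℝ) * θ ⟨i.val / 2, by have := i.isLt; omega⟩)
        else Real.cos ((m : ℝ) * θ ⟨i.val / 2, by have := i.isLt; omega⟩)
    else 0

/-- Vertical concatenation `[A; B]` of token matrices (tokens are rows). -/
def vcat {M N d : ℕ} (A : Matrix (Fin M) (Fin d) ℝ) (B : Matrix (Fin N) (Fin d) ℝ) :
    Matrix (Fin (M + N)) (Fin d) ℝ :=
  Matrix.of (Fin.append A B)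

/-- A sum over `Fin (2 * h)` splits into sums over even and odd indices. -/
theorem sum_fin_two_mul (h : ℕ) (f : Fin (2 * h) → ℝ) :
    ∑ k, f k = ∑ t : Fin h, (f ⟨2 * t.val, by omega⟩ + f ⟨2 * t.val + 1, by omega⟩) := by
  rw [← Equiv.sum_comp (finProdFinEquiv.trans (finCongr (Nat.mul_comm h 2))) f,
    Fintype.sum_prod_type]
  refine Finset.sum_congr rfl fun t _ => ?_
  rw [Fin.sum_univ_two]
  congr 2
  · ext
    simp
  · ext
    simp [Nat.add_comm]

theorem rotary_mul_rotary (h : ℕ) (θ : Fin h → ℝ) (m n : ℤ) :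
    rotary h θ m * rotary h θ n = rotary h θ (m + n) := by
  ext i j
  have hi : i.val / 2 < h := by omega
  rw [Matrix.mul_apply, sum_fin_two_mul, Finset.sum_eq_single ⟨i.val / 2, hi⟩]
  · have h1 : (2 * (i.val / 2) + 1) / 2 = i.val / 2 := by omega
    have h2 : (2 * (i.val / 2)) / 2 = i.val / 2 := by omega
    have h3 : (2 * (i.val / 2) + 1) % 2 = 1 := by omega
    have h4 : (2 * (i.val / 2)) % 2 = 0 := by omega
    simp only [rotary, Matrix.of_apply, h1, h2, h3, h4, Int.cast_add, add_mul,
      Real.cos_add, Real.sin_add, if_true, one_ne_zero, if_false]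
    split_ifs <;> ring
  · intro t _ ht
    have h1 : (2 * t.val + 1) / 2 = t.val := by omega
    have h2 : (2 * t.val) / 2 = t.val := by omega
    have h3 : i.val / 2 ≠ t.val := fun h => ht (Fin.ext h.symm)
    simp [rotary, h1, h2, h3]
  · simp

/-- The positions up to `M + i` are the first `M` positions followed by the shifts of those
up to `i`. -/
theorem sum_Iic_natAdd {α : Type*} [AddCommMonoid α] {M N : ℕ} (i : Fin N)
    (f : Fin (M + N) → α) :
    ∑ j ∈ Finset.Iic (Fin.natAdd M i), f j =
      ∑ j : Fin M, f (Fin.castAdd N j) + ∑ j ∈ Finset.Iic i, f (Fin.natAdd M j) := by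
  have mem (j : Fin M) : Fin.castAdd N j ≤ Fin.natAdd M i := by
    simp only [Fin.le_def, Fin.val_castAdd, Fin.val_natAdd]
    omega
  have filter_le {n : ℕ} (k : Fin n) : Finset.Iic k = Finset.univ.filter (· ≤ k) := by
    ext
    simp
  rw [filter_le, filter_le, Finset.sum_filter, Finset.sum_filter, Fin.sum_univ_add]
  simp [mem]

/-- **Decomposition of the rotary-encoded Key-Value matrix of a concatenated
input**: for every position `i` of the input part,
`Σ_{j=1}^{M+i} R_{Θ,j} φ(K''_j) V''_jᵀ
  = R_{Θ,M} (Σ_{j=1}^{i} R_{Θ,j} φ(K_j) V_jᵀ + Σ_{j=1}^{M} R_{Θ,j−M} φ(K'_j) V'_jᵀ)`,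
where `K''`, `V''` are the Keys/Values of `[X'; X]`, `K`, `V` those of `X` and
`K'`, `V'` those of `X'`. -/
theorem kv_sum_concat_decomposition {din dV h M N : ℕ}
    (θ : Fin h → ℝ)
    (WK : Matrix (Fin din) (Fin (2 * h)) ℝ) (WV : Matrix (Fin din) (Fin dV) ℝ)
    (φ : (Fin (2 * h) → ℝ) → (Fin (2 * h) → ℝ))
    (X' : Matrix (Fin M) (Fin din) ℝ)
    (X : Matrix (Fin N) (Fin din) ℝ) (i : Fin N) :
    (∑ j ∈ Finset.Iic (Fin.natAdd M i),
        Matrix.vecMulVec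
          ((rotary h θ (j.val + 1)).mulVec (φ (Matrix.vecMul (vcat X' X j) WK)))
          (Matrix.vecMul (vcat X' X j) WV))
      = rotary h θ (M : ℤ) *
        ((∑ j ∈ Finset.Iic i,
            Matrix.vecMulVec
              ((rotary h θ (j.val + 1)).mulVec (φ (Matrix.vecMul (X j) WK)))
              (Matrix.vecMul (X j) WV))
          + ∑ j : Fin M,
              Matrix.vecMulVec
                ((rotary h θ ((j.val + 1 : ℤ) - M)).mulVec (φ (Matrix.vecMul (X' j) WK)))
                (Matrix.vecMul (X' j) WV)) := by
  have key (n : ℤ) (v : Fin (2 * h) → ℝ) (w : Fin dV → ℝ) :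
      rotary h θ M * Matrix.vecMulVec ((rotary h θ n).mulVec v) w =
        Matrix.vecMulVec ((rotary h θ (M + n)).mulVec v) w := by
    rw [Matrix.mul_vecMulVec, Matrix.mulVec_mulVec, rotary_mul_rotary]
  have vcat_left (j : Fin M) : vcat X' X (Fin.castAdd N j) = X' j := Fin.append_left X' X j
  have vcat_right (j : Fin N) : vcat X' X (Fin.natAdd M j) = X j := Fin.append_right X' X j
  rw [sum_Iic_natAdd, add_comm]
  simp only [Matrix.mul_add, Matrix.mul_sum, key, vcat_left, vcat_right, Fin.val_castAdd,
    Fin.val_natAdd, Nat.cast_add, add_assoc, add_sub_cancel]
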